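/- arXiv:1810.05847 — 2 statements merged into one kernel-verified Lean document; each statement's English description precedes it below -/
import Mathlib

section
/- Let S : Ω → ℂ, with Ω ⊂ 𝔻 (the open unit disk) having an accumulation point in 𝔻, and suppose the kernel K_S(z,w) = (1 - S(z)·conj(S(w)))/(1 - z·conj(w)) is positive definite on Ω. Then S extends to a unique analytic function on 𝔻 with |S(z)| ≤ 1 for all z ∈ 𝔻 (a Schur function) whose restriction to Ω is S. -/
open Complex

section SchurAux

open Filter Topology ComplexConjugate

noncomputable abbrev HardyAux : Type := lp (fun _ : ℕ => ℂ) 2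

lemma szegoAux_mem (w : ℂ) (hw : ‖w‖ < 1) : Memℓp (fun n : ℕ => (conj w) ^ n) 2 := by
  apply memℓp_gen
  have h : Summable fun n : ℕ => (‖w‖ ^ 2) ^ n :=
    summable_geometric_of_lt_one (by positivity) (by nlinarith [norm_nonneg w])
  refine h.congr fun n => ?_
  simp [← pow_mul, mul_comm]

noncomputable def szegoAux (w : ℂ) : HardyAux :=
  open Classical in
  if h : ‖w‖ < 1 then ⟨fun n : ℕ => (conj w) ^ n, szegoAux_mem w h⟩ else 0

lemma szegoAux_apply (w : ℂ) (hw : ‖w‖ < 1) (n : ℕ) : szegoAux w n = (conj w) ^ n := by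
  simp [szegoAux, hw]

lemma szegoAux_hasSum (w : ℂ) (hw : ‖w‖ < 1) (f : HardyAux) :
    HasSum (fun n : ℕ => w ^ n * f n) (inner ℂ (szegoAux w) f) := by
  have h := lp.hasSum_inner (𝕜 := ℂ) (szegoAux w) f
  have e : (fun n : ℕ => w ^ n * f n) = fun n => inner ℂ (szegoAux w n) (f n) := by
    funext n
    rw [szegoAux_apply w hw]
    simp [mul_comm]
  rw [e]
  exact h

lemma szegoAux_inner (z w : ℂ) (hz : ‖z‖ < 1) (hw : ‖w‖ < 1) :
    inner ℂ (szegoAux z) (szegoAux w) = 1 / (1 - z * conj w) := by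
  have h := szegoAux_hasSum z hz (szegoAux w)
  have h2 : HasSum (fun n : ℕ => (z * conj w) ^ n) (1 - z * conj w)⁻¹ := by
    apply hasSum_geometric_of_norm_lt_one
    rw [norm_mul, RCLike.norm_conj]
    nlinarith [norm_nonneg z, norm_nonneg w]
  rw [one_div]
  refine h.unique ?_
  convert h2 using 2 with n
  rw [szegoAux_apply w hw, mul_pow]

lemma szegoAux_diff (f : HardyAux) :
    DifferentiableOn ℂ (fun z => inner ℂ (szegoAux z) f) (Metric.ball (0 : ℂ) 1) := by
  intro z hz
  rw [mem_ball_zero_iff] at hz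
  obtain ⟨r, hzr, hr⟩ := exists_between hz
  have hr0 : 0 ≤ r := (norm_nonneg z).trans hzr.le
  have h := differentiableOn_tsum_of_summable_norm (U := Metric.ball (0 : ℂ) r)
    (F := fun (n : ℕ) (w : ℂ) => w ^ n * f n) (u := fun n => r ^ n * ‖f‖)
    ((summable_geometric_of_lt_one hr0 hr).mul_right _)
    (fun n => by fun_prop) Metric.isOpen_ball
    (fun n w hw => by
      rw [mem_ball_zero_iff] at hw
      rw [norm_mul, norm_pow]
      have := lp.norm_apply_le_norm (by norm_num) f n
      gcongr)
  have hn : Metric.ball (0 : ℂ) r ∈ 𝓝 z := Metric.isOpen_ball.mem_nhds (by simpa using hzr)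
  refine (DifferentiableAt.congr_of_eventuallyEq (h.differentiableAt hn) ?_).differentiableWithinAt
  filter_upwards [hn] with w hw
  rw [mem_ball_zero_iff] at hw
  exact (szegoAux_hasSum w (hw.trans hr) f).tsum_eq.symm

lemma szegoAux_eq_zero (f : HardyAux)
    (h : ∀ z ∈ Metric.ball (0 : ℂ) 1, inner ℂ (szegoAux z) f = 0) : f = 0 := by
  have h1 : HasFPowerSeriesAt (0 : ℂ → ℂ)
      (FormalMultilinearSeries.ofScalars ℂ (fun n => f n)) 0 := by
    rw [hasFPowerSeriesAt_iff']
    filter_upwards [Metric.isOpen_ball.mem_nhds (Metric.mem_ball_self (x := (0 : ℂ)) one_pos)]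
      with z hz
    have := szegoAux_hasSum z (by simpa using hz) f
    rw [h z hz] at this
    simpa [FormalMultilinearSeries.coeff_ofScalars] using this
  have h2 := h1.eq_zero
  ext n
  have h3 := FormalMultilinearSeries.coeff_ofScalars (p := fun n => f n) (n := n)
  rw [h2] at h3
  simpa [FormalMultilinearSeries.coeff] using h3.symm

lemma identAux (Ω : Set ℂ)
    (hacc : ∃ z₀ ∈ Metric.ball (0 : ℂ) 1, AccPt z₀ (Filter.principal Ω))
    (f g : ℂ → ℂ) (hf : DifferentiableOn ℂ f (Metric.ball (0 : ℂ) 1))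
    (hg : DifferentiableOn ℂ g (Metric.ball (0 : ℂ) 1)) (h : ∀ z ∈ Ω, f z = g z) :
    Set.EqOn f g (Metric.ball (0 : ℂ) 1) := by
  obtain ⟨z₀, hz₀, ha⟩ := hacc
  rw [accPt_iff_frequently_nhdsNE] at ha
  exact (hf.analyticOnNhd Metric.isOpen_ball).eqOn_of_preconnected_of_frequently_eq
    (hg.analyticOnNhd Metric.isOpen_ball) (convex_ball _ _).isPreconnected hz₀ (ha.mono h)

lemma normAux (Ω : Set ℂ) (hΩ : Ω ⊆ Metric.ball (0 : ℂ) 1) (S : ℂ → ℂ)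
    (hpos : ∀ (M : ℕ) (w : Fin M → ℂ), (∀ k, w k ∈ Ω) → ∀ c : Fin M → ℂ,
      0 ≤ (∑ k, ∑ l, starRingEnd ℂ (c k) *
        ((1 - S (w k) * starRingEnd ℂ (S (w l))) /
          (1 - w k * starRingEnd ℂ (w l))) * c l).re) (c : Ω →₀ ℂ) :
    ‖Finsupp.linearCombination ℂ (fun w : Ω => conj (S w) • szegoAux w) c‖ ≤
      1 * ‖Finsupp.linearCombination ℂ (fun w : Ω => szegoAux w) c‖ := by
  rw [one_mul]
  have hb : ∀ w : Ω, ‖(w : ℂ)‖ < 1 := fun w => by simpa using hΩ w.2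
  let e := c.support.equivFin
  have key : ∀ v : Ω → HardyAux, Finsupp.linearCombination ℂ v c =
      ∑ k, c (e.symm k) • v (e.symm k) := by
    intro v
    rw [Finsupp.linearCombination_apply, Finsupp.sum, ← Finset.sum_coe_sort,
      ← e.symm.sum_comp]
  have h := hpos _ (fun k => ((e.symm k : Ω) : ℂ)) (fun k => (e.symm k : Ω).2)
    (fun k => c (e.symm k))
  have heq : (∑ k, ∑ l, conj (c (e.symm k)) *
        ((1 - S (e.symm k : Ω) * conj (S (e.symm l : Ω))) /
          (1 - ((e.symm k : Ω) : ℂ) * conj ((e.symm l : Ω) : ℂ))) * c (e.symm l)) =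
      inner ℂ (Finsupp.linearCombination ℂ (fun w : Ω => szegoAux w) c)
        (Finsupp.linearCombination ℂ (fun w : Ω => szegoAux w) c) -
      inner ℂ (Finsupp.linearCombination ℂ (fun w : Ω => conj (S w) • szegoAux w) c)
        (Finsupp.linearCombination ℂ (fun w : Ω => conj (S w) • szegoAux w) c) := by
    rw [key, key, sum_inner, sum_inner, ← Finset.sum_sub_distrib]
    refine Finset.sum_congr rfl fun k _ => ?_
    rw [inner_sum, inner_sum, ← Finset.sum_sub_distrib]
    refine Finset.sum_congr rfl fun l _ => ?_
    simp only [inner_smul_left, inner_smul_right, szegoAux_inner _ _ (hb _) (hb _), conj_conj]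
    ring
  have hre : ∀ x : HardyAux, (inner ℂ x x : ℂ).re = ‖x‖ ^ 2 :=
    fun x => inner_self_eq_norm_sq (𝕜 := ℂ) x
  rw [heq, Complex.sub_re, hre, hre, sub_nonneg] at h
  exact (abs_le_of_sq_le_sq' h (norm_nonneg _)).2

end SchurAux

/-- If `S : Ω → ℂ`, with `Ω ⊆ 𝔻` having an accumulation point in `𝔻`, is such
that the kernel `K_S(z,w) = (1 - S(z)conj(S(w)))/(1 - z conj(w))` is positive
definite on `Ω`, then `S` is the restriction of a uniquely determined Schur
function on `𝔻`. -/
theorem stmt14 (Ω : Set ℂ) (hΩ : Ω ⊆ Metric.ball (0 : ℂ) 1)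
    (hacc : ∃ z₀ ∈ Metric.ball (0 : ℂ) 1, AccPt z₀ (Filter.principal Ω))
    (S : ℂ → ℂ)
    (hpos : ∀ (M : ℕ) (w : Fin M → ℂ), (∀ k, w k ∈ Ω) → ∀ c : Fin M → ℂ,
      0 ≤ (∑ k, ∑ l, starRingEnd ℂ (c k) *
        ((1 - S (w k) * starRingEnd ℂ (S (w l))) /
          (1 - w k * starRingEnd ℂ (w l))) * c l).re) :
    ∃ g : ℂ → ℂ,
      (DifferentiableOn ℂ g (Metric.ball (0 : ℂ) 1) ∧
        (∀ z ∈ Metric.ball (0 : ℂ) 1, ‖g z‖ ≤ 1) ∧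
        (∀ z ∈ Ω, g z = S z)) ∧
      ∀ g' : ℂ → ℂ,
        (DifferentiableOn ℂ g' (Metric.ball (0 : ℂ) 1) ∧
          (∀ z ∈ Metric.ball (0 : ℂ) 1, ‖g' z‖ ≤ 1) ∧
          (∀ z ∈ Ω, g' z = S z)) →
        Set.EqOn g g' (Metric.ball (0 : ℂ) 1) := by
  have hd : DenseRange (Finsupp.linearCombination ℂ (fun w : Ω => szegoAux w)) := by
    change Dense (Set.range _)
    rw [← LinearMap.coe_range, Submodule.dense_iff_topologicalClosure_eq_top,
      Submodule.topologicalClosure_eq_top_iff, Submodule.eq_bot_iff]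
    intro f hf
    apply szegoAux_eq_zero
    refine identAux Ω hacc _ _ (szegoAux_diff f) (differentiableOn_const 0) fun z hz => ?_
    exact (Submodule.mem_orthogonal _ _).1 hf _ ⟨Finsupp.single ⟨z, hz⟩ 1, by simp⟩
  have hn := normAux Ω hΩ S hpos
  obtain ⟨T, hT1, hT2⟩ : ∃ T : HardyAux →L[ℂ] HardyAux, (∀ x, ‖T x‖ ≤ 1 * ‖x‖) ∧
      ∀ w ∈ Ω, T (szegoAux w) = starRingEnd ℂ (S w) • szegoAux w := by
    refine ⟨LinearMap.extendOfNorm _ _, LinearMap.norm_extendOfNorm_apply_le hd 1 hn, ?_⟩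
    intro w hw
    have := LinearMap.extendOfNorm_eq hd ⟨1, hn⟩ (Finsupp.single ⟨w, hw⟩ 1)
    simpa using this
  have hadj : ∀ f z, inner ℂ (szegoAux z) (T.adjoint f) = inner ℂ (T (szegoAux z)) f :=
    fun f z => ContinuousLinearMap.adjoint_inner_right T _ _
  have hΩT : ∀ f, ∀ z ∈ Ω, inner ℂ (szegoAux z) (T.adjoint f) =
      S z * inner ℂ (szegoAux z) f := by
    intro f z hz
    rw [hadj, hT2 z hz, inner_smul_left, Complex.conj_conj]
  let g : ℂ → ℂ := fun z => inner ℂ (szegoAux z) (T.adjoint (szegoAux 0))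
  have hg : DifferentiableOn ℂ g (Metric.ball (0 : ℂ) 1) := szegoAux_diff _
  have hgS : ∀ z ∈ Ω, g z = S z := by
    intro z hz
    have hz1 : ‖z‖ < 1 := by simpa using hΩ hz
    simp only [g]
    rw [hΩT _ z hz, szegoAux_inner z 0 hz1 (by simp)]
    simp
  refine ⟨g, ⟨hg, ?_, hgS⟩, fun g' hg' => identAux Ω hacc _ _ hg hg'.1 fun z hz => by
    rw [hgS z hz, hg'.2.2 z hz]⟩
  intro z hz
  have hz1 : ‖z‖ < 1 := by simpa using hz
  have h1 := identAux Ω hacc _ _ (szegoAux_diff (T.adjoint (szegoAux z)))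
    (hg.mul (szegoAux_diff (szegoAux z))) (fun w hw => by
      simp only [Pi.mul_apply]
      rw [hΩT _ w hw, hgS w hw]) hz
  simp only [Pi.mul_apply] at h1
  rw [hadj] at h1
  have h2 := norm_inner_le_norm (𝕜 := ℂ) (T (szegoAux z)) (szegoAux z)
  rw [h1, norm_mul, inner_self_eq_norm_sq_to_K] at h2
  have h3 := hT1 (szegoAux z)
  have h4 : 0 < ‖szegoAux z‖ := by
    rw [norm_pos_iff]
    intro h0
    have := szegoAux_apply z hz1 0
    rw [h0] at this
    simp at this
  have h5 : ‖g z‖ * ‖szegoAux z‖ ^ 2 ≤ 1 * ‖szegoAux z‖ ^ 2 := by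
    have h6 : ‖T (szegoAux z)‖ * ‖szegoAux z‖ ≤ 1 * ‖szegoAux z‖ * ‖szegoAux z‖ := by gcongr
    have h7 : ‖((‖szegoAux z‖ : ℂ)) ^ 2‖ = ‖szegoAux z‖ ^ 2 := by simp
    have h8 := h2.trans h6
    erw [h7] at h8
    linarith
  exact le_of_mul_le_mul_right h5 (by positivity)
end

section
/- Let F be a ℂⁿˣⁿ-valued rational function of a complex variable, analytic at infinity and with no poles on the imaginary axis, such that Re F(iy) ≥ 0 (i.e. F(iy) + F(iy)^* is positive semidefinite) for all real y. Then the kernel K_F(z,w) = (F(z) + F(w)^*)/(z + conj(w)) has a finite number of negative squares on the domain of analyticity of F in the open right half-plane: there is κ ∈ ℕ such that every Hermitian matrix of the form (c_k^* K_F(z_k, z_l) c_l)_{k,l} has at most κ negative eigenvalues. -/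
open Matrix

/-- A Hermitian Gram matrix `G` has at most `κ` negative eigenvalues iff every
subspace on which its quadratic form is negative definite has dimension `≤ κ`. -/
def NegSquaresAtMost (κ : ℕ) {M : ℕ} (G : Matrix (Fin M) (Fin M) ℂ) : Prop :=
  ∀ W : Submodule ℂ (Fin M → ℂ),
    (∀ v ∈ W, v ≠ 0 → (star v ⬝ᵥ (G *ᵥ v)).re < 0) → Module.finrank ℂ W ≤ κ

open Filter Topology

lemma aux_lim (z w : ℂ) : Tendsto (fun y : ℝ =>
    Complex.I * (Complex.log (z - y * Complex.I) - Complex.log (w + y * Complex.I)))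
    atTop (𝓝 (Real.pi : ℂ)) := by
  have hinv : Tendsto (fun y : ℝ => ((y⁻¹ : ℝ) : ℂ)) atTop (𝓝 0) := by
    have := (Complex.continuous_ofReal.tendsto 0).comp tendsto_inv_atTop_zero
    simpa [Function.comp_def] using this
  have h1 : Tendsto (fun y : ℝ => Complex.log (z * ((y⁻¹ : ℝ) : ℂ) - Complex.I)) atTop
      (𝓝 (Complex.log (-Complex.I))) := by
    refine Tendsto.clog ?_ (by simp [Complex.slitPlane])
    simpa using (hinv.const_mul z).sub_const Complex.I
  have h2 : Tendsto (fun y : ℝ => Complex.log (w * ((y⁻¹ : ℝ) : ℂ) + Complex.I)) atTop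
      (𝓝 (Complex.log (Complex.I))) := by
    refine Tendsto.clog ?_ (by simp [Complex.slitPlane])
    simpa using (hinv.const_mul w).add_const Complex.I
  have h3 := (h1.sub h2).const_mul Complex.I
  have e : Complex.I * (Complex.log (-Complex.I) - Complex.log Complex.I) = (Real.pi : ℂ) := by
    rw [Complex.log_neg_I, Complex.log_I]
    linear_combination (-(Real.pi : ℂ)) * Complex.I_mul_I
  rw [e] at h3
  have n1 : ∀ᶠ y : ℝ in atTop, z * ((y⁻¹ : ℝ) : ℂ) - Complex.I ≠ 0 := by
    have : Tendsto (fun y : ℝ => z * ((y⁻¹ : ℝ) : ℂ) - Complex.I) atTop (𝓝 (-Complex.I)) := by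
      simpa using (hinv.const_mul z).sub_const Complex.I
    exact this.eventually_ne (by simp)
  have n2 : ∀ᶠ y : ℝ in atTop, w * ((y⁻¹ : ℝ) : ℂ) + Complex.I ≠ 0 := by
    have : Tendsto (fun y : ℝ => w * ((y⁻¹ : ℝ) : ℂ) + Complex.I) atTop (𝓝 (Complex.I)) := by
      simpa using (hinv.const_mul w).add_const Complex.I
    exact this.eventually_ne (by simp)
  refine h3.congr' ?_
  filter_upwards [n1, n2, eventually_gt_atTop 0] with y hy1 hy2 hy
  have hy' : (y : ℂ) ≠ 0 := by exact_mod_cast hy.ne'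
  have e1 : z - y * Complex.I = (y : ℂ) * (z * ((y⁻¹ : ℝ) : ℂ) - Complex.I) := by
    push_cast; field_simp
  have e2 : w + y * Complex.I = (y : ℂ) * (w * ((y⁻¹ : ℝ) : ℂ) + Complex.I) := by
    push_cast; field_simp
  rw [e1, e2, Complex.log_ofReal_mul hy hy1, Complex.log_ofReal_mul hy hy2]
  ring

lemma aux_lim' (z w : ℂ) : Tendsto (fun y : ℝ =>
    Complex.I * (Complex.log (z - y * Complex.I) - Complex.log (w + y * Complex.I)))
    atBot (𝓝 (-(Real.pi : ℂ))) := by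
  have h := ((aux_lim w z).comp tendsto_neg_atBot_atTop).neg
  refine h.congr ?_
  intro y
  simp only [Function.comp_apply, Complex.ofReal_neg]
  rw [show w - -(y : ℂ) * Complex.I = w + y * Complex.I by ring,
    show z + -(y : ℂ) * Complex.I = z - y * Complex.I by ring]
  ring

lemma aux_deriv (z w : ℂ) (hz : 0 < z.re) (hw : 0 < w.re) (y : ℝ) :
    HasDerivAt (fun y : ℝ =>
    Complex.I * (Complex.log (z - y * Complex.I) - Complex.log (w + y * Complex.I)))
    (1 / (z - y * Complex.I) + 1 / (w + y * Complex.I)) y := by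
  have h0 : HasDerivAt (fun y : ℝ => (y : ℂ) * Complex.I) Complex.I y := by
    simpa using (Complex.ofRealCLM.hasDerivAt (x := y)).mul_const Complex.I
  have h1 := (h0.const_sub z).clog_real (by left; simpa using hz)
  have h2 := (h0.const_add w).clog_real (by left; simpa using hw)
  have h3 := (h1.sub h2).const_mul Complex.I
  have e : Complex.I * (-Complex.I / (z - y * Complex.I) - Complex.I / (w + y * Complex.I)) =
      1 / (z - y * Complex.I) + 1 / (w + y * Complex.I) := by
    rw [mul_sub, ← mul_div_assoc, ← mul_div_assoc]
    simp [neg_div]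
  rw [e] at h3
  exact h3

lemma aux_core {M n : ℕ} (z : Fin M → ℂ) (hz : ∀ k, 0 < (z k).re) (u : Fin M → Fin n → ℂ)
    (A : Fin M → Matrix (Fin n) (Fin n) ℂ) (F : ℂ → Matrix (Fin n) (Fin n) ℂ)
    (hcon : ∀ i j (y : ℝ), ∑ k, star (u k i) * A k i j / (z k - y * Complex.I) =
      (∑ k, star (u k i) / (z k - y * Complex.I)) * F (y * Complex.I) i j)
    (hre : ∀ (y : ℝ) (v : Fin n → ℂ),
      0 ≤ (∑ i, ∑ j, star (v i) * F (y * Complex.I) i j * v j).re) :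
    0 ≤ (∑ i, ∑ j, ∑ k, ∑ l, star (u k i) * A k i j * u l j / (z k + star (z l))).re := by
  set Φ : ℝ → ℂ := fun y => ∑ i, ∑ j, ∑ k, ∑ l,
    (star (u k i) * A k i j * u l j / (z k + star (z l))) *
    (Complex.I * (Complex.log (z k - y * Complex.I) - Complex.log (star (z l) + y * Complex.I)))
    with hΦ
  set S : ℂ := ∑ i, ∑ j, ∑ k, ∑ l, star (u k i) * A k i j * u l j / (z k + star (z l)) with hS
  have hzs : ∀ k, 0 < (star (z k)).re := by intro k; simpa using hz k
  have top : Tendsto Φ atTop (𝓝 (S * Real.pi)) := by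
    simp only [hS, Finset.sum_mul]
    exact tendsto_finsetSum _ fun i _ => tendsto_finsetSum _ fun j _ => tendsto_finsetSum _ fun k _ =>
      tendsto_finsetSum _ fun l _ => (aux_lim _ _).const_mul _
  have bot : Tendsto Φ atBot (𝓝 (S * -Real.pi)) := by
    simp only [hS, Finset.sum_mul]
    exact tendsto_finsetSum _ fun i _ => tendsto_finsetSum _ fun j _ => tendsto_finsetSum _ fun k _ =>
      tendsto_finsetSum _ fun l _ => (aux_lim' _ _).const_mul _
  have der : ∀ y : ℝ, HasDerivAt Φ (∑ i, ∑ j, ∑ k, ∑ l,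
      (star (u k i) * A k i j * u l j / (z k + star (z l))) *
      (1 / (z k - y * Complex.I) + 1 / (star (z l) + y * Complex.I))) y := by
    intro y
    exact HasDerivAt.fun_sum fun i _ => HasDerivAt.fun_sum fun j _ => HasDerivAt.fun_sum fun k _ =>
      HasDerivAt.fun_sum fun l _ => (aux_deriv _ _ (hz k) (hzs l) y).const_mul _
  have val : ∀ y : ℝ, (∑ i, ∑ j, ∑ k, ∑ l,
      (star (u k i) * A k i j * u l j / (z k + star (z l))) *
      (1 / (z k - y * Complex.I) + 1 / (star (z l) + y * Complex.I))) =
      ∑ i, ∑ j, star (∑ l, u l i / (star (z l) + y * Complex.I)) * F (y * Complex.I) i j *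
        (∑ l, u l j / (star (z l) + y * Complex.I)) := by
    intro y
    refine Finset.sum_congr rfl fun i _ => Finset.sum_congr rfl fun j _ => ?_
    have e1 : star (∑ l, u l i / (star (z l) + y * Complex.I)) =
        ∑ k, star (u k i) / (z k - y * Complex.I) := by
      rw [star_sum]
      refine Finset.sum_congr rfl fun k _ => ?_
      simp [sub_eq_add_neg]
    rw [e1, ← hcon, Finset.sum_mul_sum]
    refine Finset.sum_congr rfl fun k _ => Finset.sum_congr rfl fun l _ => ?_
    have n1 : z k - y * Complex.I ≠ 0 := by
      intro h; have := congrArg Complex.re h; have := hz k; simp at *; linarith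
    have n2 : star (z l) + y * Complex.I ≠ 0 := by
      intro h; have := congrArg Complex.re h; have := hz l; simp at *; linarith
    have n3 : z k + star (z l) ≠ 0 := by
      intro h; have := congrArg Complex.re h; have := hz l; have := hz k; simp at *; linarith
    rw [div_add_div _ _ n1 n2, div_mul_div_comm, div_mul_div_comm,
      div_eq_div_iff (mul_ne_zero n3 (mul_ne_zero n1 n2)) (mul_ne_zero n1 n2)]
    ring
  have mono : Monotone fun y => (Φ y).re := by
    have d : ∀ y, HasDerivAt (fun y => (Φ y).re) _ y := fun y =>
      (Complex.reCLM.hasFDerivAt.comp_hasDerivAt y (der y))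
    refine monotone_of_hasDerivAt_nonneg d fun y => ?_
    simp only [Complex.reCLM_apply, Pi.zero_apply]
    rw [val]
    exact hre y _
  have t := (Complex.continuous_re.tendsto _).comp top
  have b := (Complex.continuous_re.tendsto _).comp bot
  have h1 := mono.ge_of_tendsto t 0
  have h2 := mono.le_of_tendsto b 0
  have h3 := h2.trans h1
  simp at h3
  have := Real.pi_pos
  nlinarith

lemma aux_poly (p q : Polynomial ℂ) (z : ℂ) (hz : q.eval z ≠ 0) :
    ∃ r : Polynomial ℂ, r.natDegree ≤ max p.natDegree q.natDegree ∧
      ∀ s, q.eval s ≠ 0 → s ≠ z → (p.eval z / q.eval z) / (z - s) =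
        (1 / (z - s)) * (p.eval s / q.eval s) - r.eval s / q.eval s := by
  set g : Polynomial ℂ := Polynomial.C (p.eval z / q.eval z) * q - p with hg
  have hr : g.IsRoot z := by simp [hg, Polynomial.IsRoot, div_mul_cancel₀ _ hz]
  have hgd : g.natDegree ≤ max p.natDegree q.natDegree := by
    refine (Polynomial.natDegree_sub_le _ _).trans ?_
    have := Polynomial.natDegree_C_mul_le (p.eval z / q.eval z) q
    omega
  refine ⟨g /ₘ (Polynomial.X - Polynomial.C z), ?_, ?_⟩
  · have := Polynomial.natDegree_divByMonic g (Polynomial.monic_X_sub_C z)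
    omega
  · intro s hs hsz
    have h := congrArg (Polynomial.eval s) (Polynomial.mul_divByMonic_eq_iff_isRoot.mpr hr)
    set r := g /ₘ (Polynomial.X - Polynomial.C z)
    simp only [hg, Polynomial.eval_mul, Polynomial.eval_sub, Polynomial.eval_X, Polynomial.eval_C] at h
    have hne : z - s ≠ 0 := sub_ne_zero.mpr hsz.symm
    set t := p.eval z / q.eval z
    field_simp
    linear_combination -h

/-- Let `F` be a `ℂⁿˣⁿ`-valued rational function (entrywise quotient of
polynomials), analytic at infinity, with no poles on the imaginary axis, and
`Re F(iy) ≥ 0` for all real `y`. Then the kernel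
`K_F(z,w) = (F(z) + F(w)^*)/(z + conj w)` has a finite number of negative
squares on the domain of analyticity of `F` in the open right half-plane. -/
theorem stmt17 {n : ℕ} (F : ℂ → Matrix (Fin n) (Fin n) ℂ)
    (num den : Fin n → Fin n → Polynomial ℂ)
    (hden : ∀ i j, den i j ≠ 0)
    (hrat : ∀ i j z, (den i j).eval z ≠ 0 →
      F z i j = (num i j).eval z / (den i j).eval z)
    (hinf : ∀ i j, (num i j).degree ≤ (den i j).degree)
    (hax : ∀ i j (y : ℝ), (den i j).eval ((y : ℂ) * Complex.I) ≠ 0)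
    (hre : ∀ (y : ℝ) (v : Fin n → ℂ),
      0 ≤ (star v ⬝ᵥ ((F ((y : ℂ) * Complex.I) +
        (F ((y : ℂ) * Complex.I))ᴴ) *ᵥ v)).re) :
    ∃ κ : ℕ, ∀ (M : ℕ) (z : Fin M → ℂ) (c : Fin M → Fin n → ℂ),
      (∀ k, 0 < (z k).re) → (∀ k i j, (den i j).eval (z k) ≠ 0) →
      NegSquaresAtMost κ (Matrix.of fun k l : Fin M =>
        star (c k) ⬝ᵥ (((z k + starRingEnd ℂ (z l))⁻¹ •
          (F (z k) + (F (z l))ᴴ)) *ᵥ c l)) := by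
  obtain ⟨B, hB⟩ : ∃ B : ℕ, ∀ i j, max (num i j).natDegree (den i j).natDegree < B := by
    refine ⟨(∑ i, ∑ j, max (num i j).natDegree (den i j).natDegree) + 1, fun i j => ?_⟩
    refine Nat.lt_succ_of_le ?_
    calc _ ≤ ∑ j, max (num i j).natDegree (den i j).natDegree :=
          Finset.single_le_sum (f := fun j => max (num i j).natDegree (den i j).natDegree)
            (fun _ _ => Nat.zero_le _) (Finset.mem_univ j)
      _ ≤ _ := Finset.single_le_sum
            (f := fun i => ∑ j, max (num i j).natDegree (den i j).natDegree)
            (fun _ _ => Nat.zero_le _) (Finset.mem_univ i)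
  refine ⟨Fintype.card (Fin n × Fin n × Fin B), fun M z c hz hd W hW => ?_⟩
  choose r hrdeg hr using fun k i j => aux_poly (num i j) (den i j) (z k) (hd k i j)
  let T : (Fin M → ℂ) →ₗ[ℂ] (Fin n × Fin n × Fin B → ℂ) :=
    { toFun := fun v t => ∑ k, v k * (c k t.1 * star ((r k t.1 t.2.1).coeff t.2.2))
      map_add' := by
        intro v w; ext t; simp [add_mul, Finset.sum_add_distrib]
      map_smul' := by
        intro a v; ext t; simp [Finset.mul_sum, mul_assoc] }
  have hinj : Function.Injective (T.domRestrict W) := by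
    rw [injective_iff_map_eq_zero]
    rintro ⟨v, hv⟩ hTv
    by_contra hne
    have hv0 : v ≠ 0 := by intro h; apply hne; ext1; exact h
    have hneg := hW v hv hv0
    have hT : ∀ i j, ∑ k, Polynomial.C (star (v k * c k i)) * r k i j = 0 := by
      intro i j
      ext m
      simp only [Polynomial.finset_sum_coeff, Polynomial.coeff_C_mul, Polynomial.coeff_zero]
      by_cases hm : m < B
      · have h := congrArg star (congrFun hTv (i, j, ⟨m, hm⟩))
        simp only [LinearMap.domRestrict_apply, T, LinearMap.coe_mk, AddHom.coe_mk, star_sum,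
          Pi.zero_apply, star_zero] at h
        rw [← h]
        refine Finset.sum_congr rfl fun k _ => ?_
        simp [mul_assoc]
      · refine Finset.sum_eq_zero fun k _ => ?_
        rw [Polynomial.coeff_eq_zero_of_natDegree_lt, mul_zero]
        exact ((hrdeg k i j).trans_lt (hB i j)).trans_le (not_lt.mp hm)
    have key := aux_core z hz (fun k i => v k * c k i) (fun k => F (z k)) F ?_ ?_
    · refine absurd hneg (not_lt.mpr ?_)
      set S := ∑ i, ∑ j, ∑ k, ∑ l, star (v k * c k i) * F (z k) i j * (v l * c l j) /
        (z k + star (z l)) with hS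
      have hs : S = ∑ k, ∑ l, ∑ i, ∑ j, star (v k * c k i) * F (z k) i j * (v l * c l j) /
        (z k + star (z l)) := by
        rw [hS]
        calc _ = ∑ i, ∑ k, ∑ j, ∑ l, star (v k * c k i) * F (z k) i j * (v l * c l j) /
                (z k + star (z l)) := Finset.sum_congr rfl fun i _ => Finset.sum_comm
          _ = ∑ i, ∑ k, ∑ l, ∑ j, star (v k * c k i) * F (z k) i j * (v l * c l j) /
                (z k + star (z l)) := Finset.sum_congr rfl fun i _ =>
                  Finset.sum_congr rfl fun k _ => Finset.sum_comm
          _ = ∑ k, ∑ i, ∑ l, ∑ j, star (v k * c k i) * F (z k) i j * (v l * c l j) /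
                (z k + star (z l)) := Finset.sum_comm
          _ = _ := Finset.sum_congr rfl fun k _ => Finset.sum_comm
      have hs2 : star S = ∑ k, ∑ l, ∑ i, ∑ j, star (v k * c k i) * star (F (z l) j i) *
          (v l * c l j) / (z k + star (z l)) := by
        rw [hs, Finset.sum_comm]
        simp only [star_sum]
        refine Finset.sum_congr rfl fun k _ => Finset.sum_congr rfl fun l _ => ?_
        rw [Finset.sum_comm]
        refine Finset.sum_congr rfl fun i _ => Finset.sum_congr rfl fun j _ => ?_
        simp only [star_div₀, star_mul', star_add, star_star]
        rw [add_comm (star (z l))]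
        ring
      have hform : (star v ⬝ᵥ ((Matrix.of fun k l : Fin M =>
        star (c k) ⬝ᵥ (((z k + starRingEnd ℂ (z l))⁻¹ •
          (F (z k) + (F (z l))ᴴ)) *ᵥ c l)) *ᵥ v)) = S + star S := by
        rw [hs2, hs]
        simp only [← Finset.sum_add_distrib]
        simp only [dotProduct, Matrix.mulVec, Finset.mul_sum, Finset.sum_mul, Matrix.of_apply]
        refine Finset.sum_congr rfl fun k _ => Finset.sum_congr rfl fun l _ =>
          Finset.sum_congr rfl fun i _ => Finset.sum_congr rfl fun j _ => ?_
        simp only [Matrix.smul_apply, Matrix.add_apply, Matrix.conjTranspose_apply, smul_eq_mul,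
          Pi.star_apply, star_mul', starRingEnd_apply, div_eq_mul_inv]
        ring
      rw [hform]
      have : (star S).re = S.re := Complex.conj_re S
      rw [Complex.add_re, this]
      linarith
    · intro i j y
      have hne : ∀ k, (y : ℂ) * Complex.I ≠ z k := by
        intro k h
        have := congrArg Complex.re h
        have := hz k
        simp at *
        linarith
      have h0 := congrArg (Polynomial.eval ((y : ℂ) * Complex.I)) (hT i j)
      simp only [Polynomial.eval_finset_sum, Polynomial.eval_mul, Polynomial.eval_C,
        Polynomial.eval_zero] at h0
      have : ∀ k, star (v k * c k i) * F (z k) i j / (z k - y * Complex.I) =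
          star (v k * c k i) / (z k - y * Complex.I) * F (y * Complex.I) i j -
          star (v k * c k i) * (r k i j).eval ((y : ℂ) * Complex.I) *
            ((den i j).eval ((y : ℂ) * Complex.I))⁻¹ := by
        intro k
        rw [mul_div_assoc, hrat i j _ (hd k i j), hr k i j _ (hax i j y) (hne k),
          hrat i j _ (hax i j y)]
        ring
      simp only [this, Finset.sum_sub_distrib, ← Finset.sum_mul]
      rw [h0]
      ring
    · intro y x
      have h := hre y x
      set A := F ((y : ℂ) * Complex.I)
      set S := ∑ i, ∑ j, star (x i) * A i j * x j with hS
      have hs2 : star S = ∑ i, ∑ j, star (x i) * star (A j i) * x j := by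
        rw [hS, Finset.sum_comm]
        simp only [star_sum]
        refine Finset.sum_congr rfl fun i _ => Finset.sum_congr rfl fun j _ => ?_
        simp only [star_mul', star_star]
        ring
      have hform : star x ⬝ᵥ ((A + Aᴴ) *ᵥ x) = S + star S := by
        rw [hs2, hS]
        simp only [← Finset.sum_add_distrib]
        simp only [dotProduct, Matrix.mulVec, Finset.mul_sum]
        refine Finset.sum_congr rfl fun i _ => Finset.sum_congr rfl fun j _ => ?_
        simp only [Matrix.add_apply, Matrix.conjTranspose_apply, Pi.star_apply]
        ring
      rw [hform, Complex.add_re] at h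
      have : (star S).re = S.re := Complex.conj_re S
      rw [this] at h
      linarith
  have := LinearMap.finrank_le_finrank_of_injective hinj
  simpa only [Module.finrank_fintype_fun_eq_card] using this
end
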